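/- Let Λ = ℤ⁸ with standard basis (e, f, e₁, f₁, e₂, f₂, v₁, v₂) and the symmetric bilinear form B determined by B(e,f) = B(e₁,f₁) = B(e₂,f₂) = 1, B(v₁,v₁) = B(v₂,v₂) = −2, all other pairings of distinct basis vectors equal to 0, and B(e,e) = B(f,f) = B(e₁,e₁) = B(f₁,f₁) = B(e₂,e₂) = B(f₂,f₂) = 0 (the lattice U ⊕ U ⊕ U ⊕ A₁(−1)^{⊕2}). Let t be an integer and h = 2e + 2t·f − v₁ − v₂. Then {x ∈ ℤ⁸ : B(x,h) = 0} is the subgroup generated by e₁, f₁, e₂, f₂, f − v₁, f − v₂, and e − t·f. -/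

import Mathlib

/-- The bilinear form of the OG6 lattice `U ⊕ U ⊕ U ⊕ A₁(−1)^{⊕2}` on `ℤ⁸` with
basis `(e, f, e₁, f₁, e₂, f₂, v₁, v₂)`. -/
def BOG6 (x y : Fin 8 → ℤ) : ℤ :=
  x 0 * y 1 + x 1 * y 0 + x 2 * y 3 + x 3 * y 2 + x 4 * y 5 + x 5 * y 4
    - 2 * x 6 * y 6 - 2 * x 7 * y 7

/-- The orthogonal complement of `h = 2e + 2t·f − v₁ − v₂` in the OG6 lattice is
generated by `e₁, f₁, e₂, f₂, f − v₁, f − v₂, e − t·f`. -/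
theorem stmt9 (t : ℤ) :
    {x : Fin 8 → ℤ | BOG6 x ![2, 2 * t, 0, 0, 0, 0, -1, -1] = 0}
      = ((AddSubgroup.closure
          { ![0, 0, 1, 0, 0, 0, 0, 0], ![0, 0, 0, 1, 0, 0, 0, 0],
            ![0, 0, 0, 0, 1, 0, 0, 0], ![0, 0, 0, 0, 0, 1, 0, 0],
            ![0, 1, 0, 0, 0, 0, -1, 0], ![0, 1, 0, 0, 0, 0, 0, -1],
            ![1, -t, 0, 0, 0, 0, 0, 0] } : AddSubgroup (Fin 8 → ℤ)) :
          Set (Fin 8 → ℤ)) := by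
  ext x
  simp only [Set.mem_setOf_eq, SetLike.mem_coe]
  constructor
  · intro hx
    have h1 : x 1 = -t * x 0 - x 6 - x 7 := by
      simp [BOG6] at hx
      linarith
    have hdec : x = x 2 • ![0, 0, 1, 0, 0, 0, 0, 0] + x 3 • ![0, 0, 0, 1, 0, 0, 0, 0]
        + x 4 • ![0, 0, 0, 0, 1, 0, 0, 0] + x 5 • ![0, 0, 0, 0, 0, 1, 0, 0]
        + (-x 6) • ![0, 1, 0, 0, 0, 0, -1, 0] + (-x 7) • ![0, 1, 0, 0, 0, 0, 0, -1]
        + x 0 • ![1, -t, 0, 0, 0, 0, 0, 0] := by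
      funext i
      fin_cases i <;> simp
      rw [h1]; ring
    rw [hdec]
    refine add_mem (add_mem (add_mem (add_mem (add_mem (add_mem ?_ ?_) ?_) ?_) ?_) ?_) ?_ <;>
      exact zsmul_mem (AddSubgroup.subset_closure (by simp)) _
  · intro hx
    induction hx using AddSubgroup.closure_induction with
    | mem y hy =>
      simp only [Set.mem_insert_iff, Set.mem_singleton_iff] at hy
      rcases hy with rfl | rfl | rfl | rfl | rfl | rfl | rfl <;> simp [BOG6, mul_comm]
    | zero => simp [BOG6]
    | add y z _ _ hy hz =>
      simp [BOG6] at hy hz ⊢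
      linarith
    | neg y _ hy =>
      simp [BOG6] at hy ⊢
      linarith
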